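/- arXiv:1102.2316 — 3 statements merged into one kernel-verified Lean document; each statement's English description precedes it below -/
import Mathlib

section
/- Weyl integration formula for SU(2): let μ be the Haar probability measure on the compact group SU(2) and let f : SU(2) → ℂ be a continuous class function, i.e. f(x·y·x⁻¹) = f(y) for all x, y ∈ SU(2). Then ∫_{SU(2)} f dμ = (1/π) · ∫₀^{2π} f(T(θ)) · sin²θ dθ. -/
open Matrix Complex MeasureTheory

/-- The diagonal matrix `T(θ) = diag(e^{iθ}, e^{-iθ})`. -/
noncomputable def Tmat (θ : ℝ) : Matrix (Fin 2) (Fin 2) ℂ :=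
  !![Complex.exp (θ * Complex.I), 0; 0, Complex.exp (-θ * Complex.I)]

theorem Tmat_mem (θ : ℝ) : Tmat θ ∈ Matrix.specialUnitaryGroup (Fin 2) ℂ := by
  rw [Matrix.mem_specialUnitaryGroup_iff]
  have key : ∀ t : ℝ, Complex.exp ((t : ℂ) * Complex.I) *
      (starRingEnd ℂ) (Complex.exp ((t : ℂ) * Complex.I)) = 1 := by
    intro t
    rw [← Complex.exp_conj, ← Complex.exp_add]
    have : (t : ℂ) * Complex.I + (starRingEnd ℂ) ((t : ℂ) * Complex.I) = 0 := by
      simp [Complex.conj_ofReal]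
    rw [this, Complex.exp_zero]
  constructor
  · rw [Matrix.mem_unitaryGroup_iff]
    have key2 : ∀ t : ℝ, Complex.exp (-((t : ℂ) * Complex.I)) *
        (starRingEnd ℂ) (Complex.exp (-((t : ℂ) * Complex.I))) = 1 := by
      intro t
      have := key (-t)
      push_cast at this
      convert this using 3 <;> ring_nf
    ext i j
    fin_cases i <;> fin_cases j <;>
      simp [Tmat, Matrix.mul_apply, Fin.sum_univ_two, Matrix.conjTranspose_apply, key, key2]
  · rw [Tmat, Matrix.det_fin_two_of]
    rw [mul_comm, ← Complex.exp_add]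
    ring_nf
    simp

/-- `SU(2)`, the group of `2 × 2` complex unitary matrices of determinant 1, realized as the
kernel of the determinant on the unitary group. -/
noncomputable def SU2 : Subgroup ↥(Matrix.unitaryGroup (Fin 2) ℂ) :=
  MonoidHom.ker (Matrix.detMonoidHom.comp (Submonoid.subtype (Matrix.unitaryGroup (Fin 2) ℂ)))

/-- `T(θ)` as an element of `SU(2)`. -/
noncomputable def TSU2 (θ : ℝ) : SU2 :=
  ⟨⟨Tmat θ, (Tmat_mem θ).1⟩, by
    have h := (Tmat_mem θ).2
    simpa [SU2, MonoidHom.mem_ker] using h⟩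

noncomputable instance : MeasurableSpace SU2 := borel SU2

instance : BorelSpace SU2 := ⟨rfl⟩

abbrev V4 := ℝ × EuclideanSpace ℝ (Fin 3)

noncomputable def qN (v : V4) : ℝ := v.1 ^ 2 + ‖v.2‖ ^ 2

lemma qN_eq (v : V4) : qN v = v.1 ^ 2 + v.2 0 ^ 2 + v.2 1 ^ 2 + v.2 2 ^ 2 := by
  rw [qN, EuclideanSpace.real_norm_sq_eq, Fin.sum_univ_three]; ring

lemma qN_nonneg (v : V4) : 0 ≤ qN v := by unfold qN; positivity

lemma qN_eq_zero {v : V4} : qN v = 0 ↔ v = 0 := by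
  constructor
  · intro h
    have h1 : v.1 = 0 := by unfold qN at h; nlinarith [sq_nonneg v.1, sq_nonneg ‖v.2‖]
    have h2 : ‖v.2‖ = 0 := by unfold qN at h; nlinarith [sq_nonneg v.1, sq_nonneg ‖v.2‖]
    exact Prod.ext h1 (norm_eq_zero.1 h2)
  · rintro rfl; simp [qN]

lemma qN_cont : Continuous qN := by unfold qN; fun_prop

noncomputable def qR (b : V4) : V4 →ₗ[ℝ] V4 where
  toFun v := (v.1 * b.1 - v.2 0 * b.2 0 - v.2 1 * b.2 1 - v.2 2 * b.2 2,
    !₂[v.1 * b.2 0 + v.2 0 * b.1 + v.2 1 * b.2 2 - v.2 2 * b.2 1,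
      v.1 * b.2 1 - v.2 0 * b.2 2 + v.2 1 * b.1 + v.2 2 * b.2 0,
      v.1 * b.2 2 + v.2 0 * b.2 1 + v.2 2 * b.1 - v.2 1 * b.2 0])
  map_add' u v := by
    ext i
    · simp; ring
    · fin_cases i <;> simp <;> ring
  map_smul' c v := by
    ext i
    · simp; ring
    · fin_cases i <;> simp <;> ring

lemma qN_qR (b v : V4) : qN (qR b v) = qN v * qN b := by
  simp only [qN_eq, qR]; simp; ring

noncomputable def qQ (v : V4) : Matrix (Fin 2) (Fin 2) ℂ :=
  !![⟨v.1, v.2 0⟩, ⟨v.2 1, v.2 2⟩; ⟨-v.2 1, v.2 2⟩, ⟨v.1, -v.2 0⟩]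

lemma qQ_qR (b v : V4) : qQ (qR b v) = qQ v * qQ b := by
  ext i j
  fin_cases i <;> fin_cases j <;> apply Complex.ext <;> simp [qQ, qR, Matrix.mul_apply] <;> ring

lemma qQ_mem {v : V4} (h : qN v = 1) : qQ v ∈ Matrix.unitaryGroup (Fin 2) ℂ := by
  rw [qN_eq] at h
  rw [Matrix.mem_unitaryGroup_iff]
  ext i j
  fin_cases i <;> fin_cases j <;> apply Complex.ext <;>
    simp [qQ, Matrix.mul_apply, Matrix.star_apply] <;> linarith

lemma qQ_det {v : V4} (h : qN v = 1) : (qQ v).det = 1 := by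
  rw [qN_eq] at h
  rw [Matrix.det_fin_two]
  apply Complex.ext <;> simp [qQ] <;> linarith

noncomputable def qS (v : V4) (h : qN v = 1) : SU2 :=
  ⟨⟨qQ v, qQ_mem h⟩, by simpa [SU2, MonoidHom.mem_ker] using qQ_det h⟩

noncomputable def qC (g : SU2) : V4 :=
  ((g.1.1 0 0).re, !₂[(g.1.1 0 0).im, (g.1.1 0 1).re, (g.1.1 0 1).im])

lemma SU2_ext {g h : SU2} (H : g.1.1 = h.1.1) : g = h := Subtype.ext (Subtype.ext H)

lemma qQ_qC (g : SU2) : qQ (qC g) = g.1.1 := by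
  have hd : g.1.1.det = 1 := by
    have := g.2
    simpa [SU2, MonoidHom.mem_ker] using this
  have hu : star g.1.1 * g.1.1 = 1 := Matrix.mem_unitaryGroup_iff'.1 g.1.2
  have hs : star g.1.1 = g.1.1.adjugate := by
    have h2 : g.1.1 * g.1.1.adjugate = 1 := by rw [Matrix.mul_adjugate, hd, one_smul]
    calc star g.1.1 = star g.1.1 * (g.1.1 * g.1.1.adjugate) := by rw [h2, mul_one]
      _ = _ := by rw [← mul_assoc, hu, one_mul]
  rw [Matrix.adjugate_fin_two] at hs
  have h00 := congrFun (congrFun hs 0) 0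
  have h10 := congrFun (congrFun hs 1) 0
  simp [Matrix.star_apply] at h00 h10
  ext i j
  fin_cases i <;> fin_cases j
  · simp [qQ, qC]
  · simp [qQ, qC]
  · apply Complex.ext
    · have := congrArg Complex.re h10
      simp at this; simp [qQ, qC]; linarith
    · have := congrArg Complex.im h10
      simp at this; simp [qQ, qC]; linarith
  · apply Complex.ext
    · have := congrArg Complex.re h00
      simp at this; simp [qQ, qC]; linarith
    · have := congrArg Complex.im h00
      simp at this; simp [qQ, qC]; linarith

lemma qQ_det' (v : V4) : (qQ v).det = qN v := by
  rw [qN_eq, Matrix.det_fin_two]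
  apply Complex.ext
  · simp [qQ, ← Complex.ofReal_pow]; ring
  · simp [qQ, ← Complex.ofReal_pow]; ring

lemma qN_qC (g : SU2) : qN (qC g) = 1 := by
  have hd : g.1.1.det = 1 := by
    have := g.2
    simpa [SU2, MonoidHom.mem_ker] using this
  rw [← qQ_qC, qQ_det'] at hd
  exact_mod_cast hd

lemma qN_smul (c : ℝ) (v : V4) : qN (c • v) = c ^ 2 * qN v := by
  simp only [qN_eq]; simp; ring

lemma qQ_smul (c : ℝ) (v : V4) : qQ (c • v) = (c : ℂ) • qQ v := by
  ext i j
  fin_cases i <;> fin_cases j <;> apply Complex.ext <;> simp [qQ]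

lemma qN_normalize {v : V4} (h : v ≠ 0) : qN ((√(qN v))⁻¹ • v) = 1 := by
  have h0 : qN v ≠ 0 := fun h' => h (qN_eq_zero.1 h')
  rw [qN_smul, inv_pow, Real.sq_sqrt (qN_nonneg v), inv_mul_cancel₀ h0]

/-- conjugacy to the torus -/
lemma conj_torus (g : SU2) : ∃ h : SU2, g = h * TSU2 (Real.arccos (g.1.1 0 0).re) * h⁻¹ := by
  set v := qC g with hv
  have hN : qN v = 1 := qN_qC g
  have hx : (g.1.1 0 0).re = v.1 := rfl
  rw [hx]
  have hN' := hN
  rw [qN_eq] at hN'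
  have hx1 : -1 ≤ v.1 := by nlinarith [sq_nonneg (v.2 0), sq_nonneg (v.2 1), sq_nonneg (v.2 2)]
  have hx2 : v.1 ≤ 1 := by nlinarith [sq_nonneg (v.2 0), sq_nonneg (v.2 1), sq_nonneg (v.2 2)]
  set θ := Real.arccos v.1 with hθ
  have hc : Real.cos θ = v.1 := Real.cos_arccos hx1 hx2
  set s := Real.sin θ with hs
  have hss : s ^ 2 = v.2 0 ^ 2 + v.2 1 ^ 2 + v.2 2 ^ 2 := by
    have := Real.sin_sq_add_cos_sq θ
    rw [hc] at this; linarith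
  let t : V4 := (v.1, !₂[s, 0, 0])
  have hT : (TSU2 θ).1.1 = qQ t := by
    ext i j
    fin_cases i <;> fin_cases j <;> apply Complex.ext <;>
      simp [TSU2, Tmat, qQ, t, Complex.exp_re, Complex.exp_im, hc, hs]
  obtain ⟨u, hu0, hu⟩ : ∃ u : V4, u ≠ 0 ∧ qR u v = qR t u := by
    by_cases h : ((0, !₂[v.2 0 + s, v.2 1, v.2 2]) : V4) = 0
    · refine ⟨(0, !₂[0, 1, 0]), ?_, ?_⟩
      · intro h'
        have := congrArg (fun w : V4 => w.2 1) h'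
        simp at this
      · have h0 := congrArg (fun w : V4 => w.2 0) h
        have h1 := congrArg (fun w : V4 => w.2 1) h
        have h2 := congrArg (fun w : V4 => w.2 2) h
        simp at h0 h1 h2
        ext i
        · simp [qR, t, h1, h2]
        · fin_cases i <;> simp [qR, t, h1, h2] <;> linarith
    · refine ⟨_, h, ?_⟩
      ext i
      · simp [qR, t]; nlinarith
      · fin_cases i <;> simp [qR, t] <;> nlinarith
  have huN := qN_normalize hu0
  refine ⟨qS _ huN, ?_⟩
  rw [eq_mul_inv_iff_mul_eq]
  apply SU2_ext
  change g.1.1 * qQ _ = qQ _ * (TSU2 θ).1.1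
  rw [hT, ← qQ_qC g, qQ_smul, Matrix.mul_smul, Matrix.smul_mul, ← qQ_qR, ← qQ_qR, ← hv, hu]

instance : (volume : Measure V4).IsAddHaarMeasure :=
  inferInstanceAs ((volume : Measure ℝ).prod
    (volume : Measure (EuclideanSpace ℝ (Fin 3)))).IsAddHaarMeasure

def qB : Set V4 := {v | qN v ≤ 1}

lemma qB_meas : MeasurableSet qB := (isClosed_le qN_cont continuous_const).measurableSet

lemma qB_fin : volume qB < ⊤ := by
  refine lt_of_le_of_lt (measure_mono (t := Metric.closedBall (0 : V4) 1) ?_)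
    measure_closedBall_lt_top
  intro v hv
  have hv : qN v ≤ 1 := hv
  unfold qN at hv
  rw [mem_closedBall_zero_iff, Prod.norm_def, sup_le_iff, Real.norm_eq_abs]
  refine ⟨abs_le_one_iff_mul_self_le_one.2 ?_, ?_⟩
  · nlinarith [sq_nonneg ‖v.2‖]
  · nlinarith [sq_nonneg v.1, norm_nonneg v.2]

lemma qB_pos : 0 < volume qB := by
  refine lt_of_lt_of_le ?_ (measure_mono (s := {v : V4 | qN v < 1}) fun v (hv : qN v < 1) => show qN v ≤ 1 from le_of_lt hv)
  exact (isOpen_lt qN_cont continuous_const).measure_pos volume ⟨0, by simp [qN]⟩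

lemma qR_cont (b : V4) : Continuous (qR b) := (qR b).continuous_of_finiteDimensional

lemma qR_preimage {b : V4} (hb : qN b = 1) : qR b ⁻¹' qB = qB := by
  ext v; simp [qB, qN_qR, hb]

lemma qR_mp {b : V4} (hb : qN b = 1) : MeasurePreserving (qR b) volume volume := by
  have hdet : LinearMap.det (qR b) ≠ 0 := by
    intro h
    have h2 := LinearMap.bot_lt_ker_of_det_eq_zero h
    rw [bot_lt_iff_ne_bot, ne_eq, LinearMap.ker_eq_bot'] at h2
    apply h2
    intro v hv
    have := qN_qR b v
    rw [hv, hb, mul_one, qN_eq_zero.2 rfl] at this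
    exact qN_eq_zero.1 this.symm
  refine ⟨(qR_cont b).measurable, ?_⟩
  have h1 := Measure.map_linearMap_addHaar_eq_smul_addHaar (volume : Measure V4) hdet
  have h2 := congrArg (fun m => m qB) h1
  simp only [Measure.smul_apply, smul_eq_mul] at h2
  rw [Measure.map_apply (qR_cont b).measurable qB_meas, qR_preimage hb] at h2
  have h3 : ENNReal.ofReal |(LinearMap.det (qR b))⁻¹| = 1 := by
    refine (ENNReal.mul_left_inj qB_pos.ne' qB_fin.ne).1 ?_
    rw [← h2, one_mul]
  rw [h1, h3, one_smul]

lemma qR_mpB {b : V4} (hb : qN b = 1) :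
    MeasurePreserving (qR b) (volume.restrict qB) (volume.restrict qB) := by
  have := (qR_mp hb).restrict_preimage qB_meas
  rwa [qR_preimage hb] at this

instance : IsFiniteMeasure ((volume : Measure V4).restrict qB) :=
  ⟨by simpa using qB_fin⟩

lemma TSU2_cont : Continuous TSU2 := by
  apply Continuous.subtype_mk
  apply Continuous.subtype_mk
  refine continuous_matrix fun i j => ?_
  fin_cases i <;> fin_cases j <;> simp [Tmat] <;> fun_prop

lemma entry_cont (i j : Fin 2) : Continuous fun g : SU2 => g.1.1 i j :=
  (continuous_subtype_val.comp continuous_subtype_val).matrix_elem i j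

lemma haar_eq (μ : Measure SU2) [μ.IsHaarMeasure] [IsProbabilityMeasure μ]
    (f : SU2 → ℂ) (F : ℝ → ℂ) (hF : Continuous F) (C : ℝ) (hC : ∀ x, ‖F x‖ ≤ C)
    (hfF : ∀ g : SU2, f g = F (g.1.1 0 0).re) :
    (((volume : Measure V4).real qB : ℝ) : ℂ) * ∫ g, f g ∂μ
      = ∫ v in qB, F (v.1 / √(qN v)) := by
  have hFm := hF.measurable
  have hNm := qN_cont.measurable
  have e00 := (entry_cont 0 0).measurable
  have e01 := (entry_cont 0 1).measurable
  have key : ∀ g : SU2, ∫ v in qB, F ((qR (qC g) v).1 / √(qN v))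
      = ∫ v in qB, F (v.1 / √(qN v)) := by
    intro g
    have h := qR_mpB (qN_qC g)
    conv_rhs => rw [← h.map_eq]
    rw [integral_map h.measurable.aemeasurable]
    · simp only [qN_qR, qN_qC, mul_one]
    · exact Measurable.aestronglyMeasurable (by fun_prop)
  have key2 : ∀ v : V4, v ≠ 0 → ∫ g, F ((qR (qC g) v).1 / √(qN v)) ∂μ = ∫ g, f g ∂μ := by
    intro v hv
    rw [← integral_mul_left_eq_self f (qS _ (qN_normalize hv))]
    congr 1
    ext g
    rw [hfF]
    congr 1
    change _ = ((qQ ((√(qN v))⁻¹ • v) * g.1.1) 0 0).re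
    rw [qQ_smul, ← qQ_qC g, Matrix.smul_mul, ← qQ_qR]
    simp only [Matrix.smul_apply, smul_eq_mul, Complex.re_ofReal_mul]
    simp [qQ, div_eq_inv_mul]
  have hint : Integrable (fun p : V4 × SU2 => F ((qR (qC p.2) p.1).1 / √(qN p.1)))
      ((volume.restrict qB).prod μ) := by
    refine Integrable.of_bound (C := C) ?_ (Filter.Eventually.of_forall fun _ => hC _)
    apply Measurable.aestronglyMeasurable
    have he : (fun p : V4 × SU2 => (qR (qC p.2) p.1).1) = fun p : V4 × SU2 =>
        p.1.1 * (p.2.1.1 0 0).re - p.1.2 0 * (p.2.1.1 0 0).im - p.1.2 1 * (p.2.1.1 0 1).re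
          - p.1.2 2 * (p.2.1.1 0 1).im := by
      ext p; simp [qR, qC]
    have m0 : Measurable fun p : V4 × SU2 => (p.2.1.1 0 0).re :=
      Complex.measurable_re.comp (e00.comp measurable_snd)
    have m1 : Measurable fun p : V4 × SU2 => (p.2.1.1 0 0).im :=
      Complex.measurable_im.comp (e00.comp measurable_snd)
    have m2 : Measurable fun p : V4 × SU2 => (p.2.1.1 0 1).re :=
      Complex.measurable_re.comp (e01.comp measurable_snd)
    have m3 : Measurable fun p : V4 × SU2 => (p.2.1.1 0 1).im :=
      Complex.measurable_im.comp (e01.comp measurable_snd)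
    have n0 : ∀ i, Measurable fun p : V4 × SU2 => p.1.2 i := fun i =>
      (show Measurable fun v : V4 => v.2 i by fun_prop).comp measurable_fst
    have n1 : Measurable fun p : V4 × SU2 => p.1.1 := measurable_fst.comp measurable_fst
    have n2 : Measurable fun p : V4 × SU2 => √(qN p.1) :=
      (hNm.comp measurable_fst).sqrt
    have he2 : Measurable fun p : V4 × SU2 => (qR (qC p.2) p.1).1 := by
      rw [he]
      exact (((n1.mul m0).sub ((n0 0).mul m1)).sub ((n0 1).mul m2)).sub ((n0 2).mul m3)
    exact hFm.comp (he2.div n2)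
  have h1 : ∫ v in qB, ∫ g, F ((qR (qC g) v).1 / √(qN v)) ∂μ
      = ∫ v in qB, ∫ g, f g ∂μ := by
    apply integral_congr_ae
    apply ae_restrict_of_ae
    have : ∀ᵐ v : V4, v ≠ 0 := by
      simp [ae_iff]
    filter_upwards [this] with v hv using key2 v hv
  rw [integral_integral_swap hint] at h1
  simp only [key] at h1
  simp at h1
  rw [h1]

lemma polar_eq : ∃ K : ℂ, ∀ (F : ℝ → ℂ) (_ : Continuous F) (C : ℝ) (_ : ∀ x, ‖F x‖ ≤ C),
    ∫ v in qB, F (v.1 / √(qN v))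
      = K * ∫ θ in (0 : ℝ)..(2 * Real.pi), F (Real.cos θ) * ((Real.sin θ : ℂ)) ^ 2 := by
  let c3 : ℝ := 3 * (volume : Measure (EuclideanSpace ℝ (Fin 3))).real (Metric.ball 0 1)
  let k : ℂ := ∫ ρ in Set.Ioi (0 : ℝ), ((ρ ^ 3 * (if ρ ≤ 1 then 1 else 0) : ℝ) : ℂ)
  refine ⟨((c3 / 2 : ℝ) : ℂ) * k, ?_⟩
  intro F hF C hC
  have hFm := hF.measurable
  have hNm := qN_cont.measurable
  let H : ℝ → ℝ → ℂ := fun x r => if x ^ 2 + r ^ 2 ≤ 1 then F (x / √(x ^ 2 + r ^ 2)) else 0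
  have e1 : ∫ v in qB, F (v.1 / √(qN v)) = ∫ v : V4, H v.1 ‖v.2‖ := by
    rw [← integral_indicator qB_meas]
    congr 1
  have i1 : Integrable (fun v : V4 => H v.1 ‖v.2‖) := by
    have : IntegrableOn (fun v : V4 => F (v.1 / √(qN v))) qB := by
      refine Integrable.of_bound (C := C) ?_ (Filter.Eventually.of_forall fun _ => hC _)
      exact Measurable.aestronglyMeasurable (by fun_prop)
    rw [← integrable_indicator_iff qB_meas] at this
    exact this
  have e2 : ∀ x, ∫ w : EuclideanSpace ℝ (Fin 3), H x ‖w‖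
      = ((c3 / 2 : ℝ) : ℂ) * ∫ y : ℝ, ((y ^ 2 : ℝ) : ℂ) * H x y := by
    intro x
    have a1 := integral_fun_norm_addHaar (volume : Measure (EuclideanSpace ℝ (Fin 3))) (H x)
    have a2 := integral_fun_norm_addHaar (volume : Measure ℝ)
      (fun y => ((y ^ 2 : ℝ) : ℂ) * H x y)
    have a3 : ∀ y : ℝ, ((‖y‖ ^ 2 : ℝ) : ℂ) * H x ‖y‖ = ((y ^ 2 : ℝ) : ℂ) * H x y := by
      intro y; simp [H]
    simp only [a3] at a2
    have a4 : (volume : Measure ℝ).real (Metric.ball 0 1) = 2 := by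
      simp [Measure.real, Real.volume_ball]
    rw [a1, a2, a4]
    simp only [finrank_euclideanSpace, Fintype.card_fin, Module.finrank_self, c3]
    simp [Complex.real_smul]
    ring
  have i3 : Integrable (fun p : ℝ × ℝ => ((p.2 ^ 2 : ℝ) : ℂ) * H p.1 p.2) := by
    let D : Set (ℝ × ℝ) := {p | p.1 ^ 2 + p.2 ^ 2 ≤ 1}
    have hD : MeasurableSet D :=
      (isClosed_le (by fun_prop) continuous_const).measurableSet
    have hDsub : D ⊆ Metric.closedBall (0 : ℝ × ℝ) 1 := by
      intro v hv
      have hv : v.1 ^ 2 + v.2 ^ 2 ≤ 1 := hv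
      rw [mem_closedBall_zero_iff, Prod.norm_def, sup_le_iff, Real.norm_eq_abs, Real.norm_eq_abs]
      refine ⟨abs_le_one_iff_mul_self_le_one.2 ?_, abs_le_one_iff_mul_self_le_one.2 ?_⟩
      · nlinarith [sq_nonneg v.2]
      · nlinarith [sq_nonneg v.1]
    have hDf : volume D < ⊤ := lt_of_le_of_lt (measure_mono hDsub) measure_closedBall_lt_top
    have : IntegrableOn (fun p : ℝ × ℝ =>
        ((p.2 ^ 2 : ℝ) : ℂ) * F (p.1 / √(p.1 ^ 2 + p.2 ^ 2))) D := by
      have : IsFiniteMeasure ((volume : Measure (ℝ × ℝ)).restrict D) := ⟨by simpa using hDf⟩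
      refine Integrable.of_bound (C := C) ?_ ?_
      · exact Measurable.aestronglyMeasurable (by fun_prop)
      · filter_upwards [ae_restrict_mem hD] with p hp
        have hp : p.1 ^ 2 + p.2 ^ 2 ≤ 1 := hp
        rw [norm_mul, Complex.norm_real, Real.norm_eq_abs, abs_of_nonneg (sq_nonneg _)]
        have := hC (p.1 / √(p.1 ^ 2 + p.2 ^ 2))
        have h0 := norm_nonneg (F (p.1 / √(p.1 ^ 2 + p.2 ^ 2)))
        nlinarith [sq_nonneg p.1, sq_nonneg p.2]
    rw [← integrable_indicator_iff hD] at this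
    refine this.congr (Filter.Eventually.of_forall fun p => ?_)
    simp only [Set.indicator, D, Set.mem_setOf_eq, H]
    split_ifs <;> simp
  rw [e1, Measure.volume_eq_prod, integral_prod _ i1]
  simp only [e2]
  rw [integral_const_mul, mul_assoc]
  congr 1
  rw [Measure.volume_eq_prod] at i3
  rw [← integral_prod (fun p : ℝ × ℝ => ((p.2 ^ 2 : ℝ) : ℂ) * H p.1 p.2) i3,
    ← Measure.volume_eq_prod, ← integral_comp_polarCoord_symm]
  have e4 : ∫ p in polarCoord.target, p.1 • (fun p : ℝ × ℝ =>
        ((p.2 ^ 2 : ℝ) : ℂ) * H p.1 p.2) (polarCoord.symm p)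
      = ∫ p in Set.Ioi (0 : ℝ) ×ˢ Set.Ioo (-Real.pi) Real.pi,
        ((p.1 ^ 3 * (if p.1 ≤ 1 then 1 else 0) : ℝ) : ℂ)
          * (F (Real.cos p.2) * ((Real.sin p.2 : ℂ)) ^ 2) := by
    rw [polarCoord_target]
    refine setIntegral_congr_fun (measurableSet_Ioi.prod measurableSet_Ioo) ?_
    rintro ⟨ρ, θ⟩ ⟨hρ, -⟩
    have hρ : 0 < ρ := hρ
    have b1 : (ρ * Real.cos θ) ^ 2 + (ρ * Real.sin θ) ^ 2 = ρ ^ 2 := by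
      linear_combination ρ ^ 2 * Real.sin_sq_add_cos_sq θ
    have b2 : ρ ^ 2 ≤ 1 ↔ ρ ≤ 1 := by
      rw [sq_le_one_iff₀ hρ.le]
    have b3 : ρ * Real.cos θ / ρ = Real.cos θ := by field_simp
    simp only [polarCoord_symm_apply, H, b1, b2, Real.sqrt_sq hρ.le, b3, Complex.real_smul]
    split_ifs
    · push_cast; ring
    · simp
  rw [e4, Measure.volume_eq_prod, setIntegral_prod_mul
    (fun ρ : ℝ => ((ρ ^ 3 * (if ρ ≤ 1 then 1 else 0) : ℝ) : ℂ))
    (fun θ : ℝ => F (Real.cos θ) * ((Real.sin θ : ℂ)) ^ 2)]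
  congr 1
  have per : Function.Periodic (fun θ : ℝ => F (Real.cos θ) * ((Real.sin θ : ℂ)) ^ 2)
      (2 * Real.pi) := by
    intro θ; simp only [Real.cos_add_two_pi, Real.sin_add_two_pi]
  have := per.intervalIntegral_add_eq (-Real.pi) 0
  rw [zero_add] at this
  rw [← this, ← integral_Ioc_eq_integral_Ioo, show -Real.pi + 2 * Real.pi = Real.pi by ring,
    intervalIntegral.integral_of_le (by linarith [Real.pi_pos])]

lemma f_eq (f : SU2 → ℂ) (hclass : ∀ x y : SU2, f (x * y * x⁻¹) = f y) (g : SU2) :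
    f g = f (TSU2 (Real.arccos (g.1.1 0 0).re)) := by
  obtain ⟨h, hh⟩ := conj_torus g
  conv_lhs => rw [hh]
  exact hclass _ _

/-- **Weyl integration formula for `SU(2)`**: if `μ` is the Haar probability measure on
`SU(2)` and `f` is a continuous class function, then
`∫ f dμ = (1/π) ∫₀^{2π} f(T(θ)) sin²θ dθ`. -/
theorem su2_weyl_integration (μ : Measure SU2) [μ.IsHaarMeasure] [IsProbabilityMeasure μ]
    (f : SU2 → ℂ) (hf : Continuous f)
    (hclass : ∀ x y : SU2, f (x * y * x⁻¹) = f y) :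
    ∫ g, f g ∂μ =
      (1 / (Real.pi : ℂ)) *
        ∫ θ in (0 : ℝ)..(2 * Real.pi), f (TSU2 θ) * ((Real.sin θ : ℂ)) ^ 2 := by
  obtain ⟨K, hK⟩ := polar_eq
  have hFc : Continuous fun x : ℝ => f (TSU2 (Real.arccos x)) :=
    hf.comp (TSU2_cont.comp Real.continuous_arccos)
  obtain ⟨C, hC⟩ := (isCompact_Icc (a := (0 : ℝ)) (b := Real.pi)).exists_bound_of_continuousOn
    (hf.comp TSU2_cont).continuousOn
  have hFb : ∀ x : ℝ, ‖f (TSU2 (Real.arccos x))‖ ≤ C := fun x =>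
    hC _ ⟨Real.arccos_nonneg x, Real.arccos_le_pi x⟩
  have hmain := haar_eq μ f _ hFc C hFb (f_eq f hclass)
  rw [hK _ hFc C hFb] at hmain
  have hone := haar_eq μ (fun _ => 1) (fun _ => 1) continuous_const 1 (by simp) (by simp)
  rw [hK (fun _ => 1) continuous_const 1 (by simp)] at hone
  have hsin : ∫ θ in (0 : ℝ)..(2 * Real.pi), (1 : ℂ) * ((Real.sin θ : ℂ)) ^ 2 = Real.pi := by
    have h1 : ∫ θ in (0 : ℝ)..(2 * Real.pi), Real.sin θ ^ 2 = Real.pi := by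
      rw [integral_sin_sq]; simp
    rw [← h1, ← intervalIntegral.integral_ofReal]
    simp
  rw [hsin] at hone
  simp only [integral_const, probReal_univ, one_smul, mul_one] at hone
  have hcos : ∀ θ : ℝ, f (TSU2 (Real.arccos (Real.cos θ))) = f (TSU2 θ) := by
    intro θ
    rw [f_eq f hclass (TSU2 θ)]
    congr 3
    simp [TSU2, Tmat, Complex.exp_re]
  simp only [hcos] at hmain
  have hpi : (Real.pi : ℂ) ≠ 0 := by exact_mod_cast Real.pi_ne_zero
  have hv : (((volume : Measure V4).real qB : ℝ) : ℂ) ≠ 0 := by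
    have : (volume : Measure V4).real qB ≠ 0 :=
      (ENNReal.toReal_pos qB_pos.ne' qB_fin.ne).ne'
    exact_mod_cast this
  have hK0 : K ≠ 0 := by
    rintro rfl
    exact hv (by rw [hone]; simp)
  rw [hone, mul_assoc] at hmain
  have := mul_left_cancel₀ hK0 hmain
  rw [← this]
  field_simp
end

section
/- Classification of the irreducible continuous finite-dimensional representations of SU(2) by their characters: let V be a nonzero finite-dimensional complex vector space and ρ : SU(2) → GL(V) a continuous group homomorphism such that the only subspaces of V invariant under all ρ(g), g ∈ SU(2), are 0 and V. Then there exists a natural number n such that dim V = n + 1 and tr ρ(T(θ)) = Σ_{j=0}^{n} e^{i(n−2j)θ} for all θ ∈ ℝ. -/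
open Matrix Complex Finset

section analysis
set_option linter.unusedSectionVars false
open Filter Topology
variable {E : Type*} [NormedRing E] [NormedAlgebra ℝ E] [NormOneClass E]

lemma su2_pow_sub_pow (a b : E) (M : ℝ) (hM : 1 ≤ M) (ha : ‖a‖ ≤ M) (hb : ‖b‖ ≤ M) (n : ℕ) :
    ‖a ^ n - b ^ n‖ ≤ n * M ^ n * ‖a - b‖ := by
  induction n with
  | zero => simp
  | succ n ih =>
    have h1 : a ^ (n+1) - b ^ (n+1) = a ^ n * (a - b) + (a ^ n - b ^ n) * b := by
      rw [pow_succ, pow_succ]; noncomm_ring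
    have h2 : ‖a ^ n‖ ≤ M ^ n := (norm_pow_le a n).trans (by gcongr)
    have h3 : M ^ n ≤ M ^ (n+1) := pow_le_pow_right₀ hM (by omega)
    calc ‖a ^ (n+1) - b ^ (n+1)‖ ≤ ‖a ^ n * (a - b)‖ + ‖(a ^ n - b ^ n) * b‖ := by
          rw [h1]; exact norm_add_le _ _
      _ ≤ ‖a ^ n‖ * ‖a - b‖ + ‖a ^ n - b ^ n‖ * ‖b‖ := add_le_add (norm_mul_le _ _) (norm_mul_le _ _)
      _ ≤ M ^ (n+1) * ‖a - b‖ + (n * M ^ n * ‖a - b‖) * M := by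
          gcongr
          exact h2.trans h3
      _ = _ := by push_cast; ring

lemma su2_trotter_one (f g : ℝ → E) (C : E) (hf0 : f 0 = 1) (hg0 : g 0 = 1)
    (hf : HasDerivAt f C 0) (hg : HasDerivAt g C 0) :
    Tendsto (fun n : ℕ => f (1 / n) ^ n - g (1 / n) ^ n) atTop (𝓝 0) := by
  have hseq : Tendsto (fun n : ℕ => (1 / n : ℝ)) atTop (𝓝 0) := tendsto_one_div_atTop_nhds_zero_nat
  have hbound : ∀ f : ℝ → E, f 0 = 1 → HasDerivAt f C 0 →
      ∀ᶠ n : ℕ in atTop, ‖f (1 / n)‖ ≤ Real.exp ((‖C‖ + 1) / n) := by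
    intro f hf0 hf
    have h1 := (hasDerivAt_iff_isLittleO.1 hf).def (c := 1) one_pos
    filter_upwards [hseq.eventually h1] with n hn
    simp only [sub_zero, hf0, one_mul] at hn
    have hpos : (0:ℝ) ≤ 1 / n := by positivity
    rw [Real.norm_of_nonneg hpos] at hn
    have h2 : f (1 / n) = (f (1 / n) - 1 - (1 / n : ℝ) • C) + (1 + (1 / n : ℝ) • C) := by abel
    have h3 : ‖f (1 / n)‖ ≤ 1 / n + (1 + 1 / n * ‖C‖) := by
      rw [h2]
      refine (norm_add_le _ _).trans (add_le_add hn ((norm_add_le _ _).trans ?_))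
      rw [norm_one, norm_smul, Real.norm_of_nonneg hpos]
    have h4 := Real.add_one_le_exp ((‖C‖ + 1) / n)
    refine h3.trans (le_trans (le_of_eq ?_) h4)
    ring
  have hdiff : Tendsto (fun n : ℕ => (n : ℝ) * ‖f (1 / n) - g (1 / n)‖) atTop (𝓝 0) := by
    have h1 := (hf.sub hg)
    rw [sub_self] at h1
    have h2 := hasDerivAt_iff_tendsto_slope.1 h1
    have h3 : Tendsto (fun n : ℕ => (1 / n : ℝ)) atTop (𝓝[≠] 0) := by
      rw [tendsto_nhdsWithin_iff]
      refine ⟨hseq, ?_⟩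
      filter_upwards [eventually_gt_atTop 0] with n hn
      have : (n : ℝ) ≠ 0 := by positivity
      simpa using hn.ne'
    have h4 := (h2.comp h3).norm
    rw [norm_zero] at h4
    refine h4.congr fun n => ?_
    simp [slope, hf0, hg0, norm_smul]
  have hlim := hdiff.const_mul (Real.exp (‖C‖ + 1))
  rw [mul_zero] at hlim
  refine squeeze_zero_norm' ?_ hlim
  filter_upwards [hbound f hf0 hf, hbound g hg0 hg, eventually_gt_atTop 0] with n h1 h2 hn
  have := su2_pow_sub_pow _ _ _ (Real.one_le_exp (by positivity)) h1 h2 n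
  refine this.trans (le_of_eq ?_)
  rw [← Real.exp_nat_mul]
  have : (n : ℝ) ≠ 0 := by positivity
  rw [mul_div_cancel₀ _ this]
  ring

lemma su2_trotter (f g : ℝ → E) (C : E) (hf0 : f 0 = 1) (hg0 : g 0 = 1)
    (hf : HasDerivAt f C 0) (hg : HasDerivAt g C 0) (hadd : ∀ s t, g (s + t) = g s * g t) (t : ℝ) :
    Tendsto (fun n : ℕ => f (t / n) ^ n) atTop (𝓝 (g t)) := by
  have hs : ∀ f : ℝ → E, HasDerivAt f C 0 → HasDerivAt (fun x => f (t * x)) (t • C) 0 := by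
    intro f hf
    have h2 : HasDerivAt (fun x : ℝ => t * x) t 0 := by
      simpa using (hasDerivAt_id (0:ℝ)).const_mul t
    have h3 : HasDerivAt f C (t * 0) := by simpa using hf
    exact h3.scomp 0 h2
  have h := su2_trotter_one (fun x => f (t * x)) (fun x => g (t * x)) (t • C) (by simpa) (by simpa)
    (hs f hf) (hs g hg)
  have hpow : ∀ (x : ℝ) (n : ℕ), g x ^ n = g (n * x) := by
    intro x n
    induction n with
    | zero => simp [hg0]
    | succ n ih => rw [pow_succ, ih, ← hadd]; push_cast; ring_nf
  have h' := h.add_const (g t)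
  rw [zero_add] at h'
  refine h'.congr' ?_
  filter_upwards [eventually_gt_atTop 0] with n hn
  have : (n : ℝ) ≠ 0 := by positivity
  simp only [hpow, mul_one_div, mul_div_cancel₀ _ this]
  abel

lemma su2_exp_deriv [CompleteSpace E] (A : E) :
    HasDerivAt (fun t : ℝ => NormedSpace.exp (t • A)) A 0 := by
  simpa using hasDerivAt_exp_smul_const (𝕂 := ℝ) A 0

lemma su2_exp_add [CompleteSpace E] (A : E) (s t : ℝ) :
    NormedSpace.exp ((s + t) • A) = NormedSpace.exp (s • A) * NormedSpace.exp (t • A) := by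
  let _ : NormedAlgebra ℚ E := NormedAlgebra.restrictScalars ℚ ℝ E
  rw [add_smul, NormedSpace.exp_add_of_commute]
  exact ((Commute.refl A).smul_left s).smul_right t

lemma su2_one_param [CompleteSpace E] (f : ℝ → E) (hc : Continuous f) (h0 : f 0 = 1)
    (hadd : ∀ s t, f (s + t) = f s * f t) :
    ∃ A : E, ∀ t : ℝ, f t = NormedSpace.exp (t • A) := by
  -- integral primitive
  set F : ℝ → E := fun x => ∫ s in (0:ℝ)..x, f s with hF
  have hFd : ∀ x, HasDerivAt F (f x) x := fun x =>
    intervalIntegral.integral_hasDerivAt_right (hc.intervalIntegrable _ _)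
      hc.stronglyMeasurable.stronglyMeasurableAtFilter hc.continuousAt
  -- some F h is a unit
  obtain ⟨h, hu⟩ : ∃ h, IsUnit (F h) := by
    have h1 := hasDerivAt_iff_tendsto_slope.1 (hFd 0)
    rw [h0] at h1
    have h2 : ∀ᶠ x in 𝓝 (1:E), IsUnit x := Units.isOpen.mem_nhds isUnit_one
    obtain ⟨x, hx, hx0⟩ := ((h1.eventually h2).and self_mem_nhdsWithin).exists
    refine ⟨x, ?_⟩
    have hx0' : x ≠ 0 := hx0
    have : F x = algebraMap ℝ E x * slope F 0 x := by
      simp [slope, hF, ← Algebra.smul_def, smul_smul, hx0']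
    rw [this]
    exact ((isUnit_iff_ne_zero.2 hx0').map (algebraMap ℝ E)).mul hx
  obtain ⟨u, hu⟩ := hu
  have hkey : ∀ t, f t = (F (t + h) - F t) * ((u⁻¹ : Eˣ) : E) := by
    intro t
    have : f t * F h = F (t + h) - F t := by
      simp only [hF]
      rw [intervalIntegral.integral_interval_sub_left (hc.intervalIntegrable _ _)
        (hc.intervalIntegrable _ _)]
      have : ∫ s in (0:ℝ)..h, f (t + s) = ∫ s in (t + 0)..(t + h), f s :=
        intervalIntegral.integral_comp_add_left f t
      rw [add_zero] at this
      rw [← this]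
      simp only [hadd]
      exact (((ContinuousLinearMap.mul ℝ E) (f t)).intervalIntegral_comp_comm
        (hc.intervalIntegrable 0 h)).symm
    rw [← this, ← hu, Units.mul_inv_cancel_right]
  have hd0 : ∃ A, HasDerivAt f A 0 := by
    refine ⟨(f (0 + h) - f 0) * ((u⁻¹ : Eˣ) : E), ?_⟩
    have := (((hFd (0 + h)).comp_add_const 0 h).sub (hFd 0)).mul_const ((u⁻¹ : Eˣ) : E)
    exact this.congr_of_eventuallyEq (Eventually.of_forall hkey)
  obtain ⟨A, hA⟩ := hd0
  refine ⟨A, fun t => ?_⟩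
  have h1 := su2_trotter f f A h0 h0 hA hA hadd t
  have h2 := su2_trotter f (fun t => NormedSpace.exp (t • A)) A h0 (by simp) hA
    (su2_exp_deriv A) (su2_exp_add A) t
  exact tendsto_nhds_unique h1 h2

lemma su2_exp_inj [CompleteSpace E] (A B : E)
    (h : ∀ t : ℝ, NormedSpace.exp (t • A) = NormedSpace.exp (t • B)) : A = B := by
  have h1 := su2_exp_deriv A
  rw [show (fun t : ℝ => NormedSpace.exp (t • A)) = fun t : ℝ => NormedSpace.exp (t • B) from
    funext h] at h1
  exact h1.unique (su2_exp_deriv B)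

lemma su2_exp_smul_add [CompleteSpace E] (A B : E) (c s : ℝ) :
    HasDerivAt (fun t : ℝ => NormedSpace.exp ((c * t) • A) * NormedSpace.exp ((s * t) • B))
      (c • A + s • B) 0 := by
  have h1 : ∀ (c : ℝ) (A : E), HasDerivAt (fun t : ℝ => NormedSpace.exp ((c * t) • A)) (c • A) 0 := by
    intro c A
    simpa [smul_smul, mul_comm] using su2_exp_deriv (c • A)
  simpa using (h1 c A).fun_mul (h1 s B)

end analysis

section sl2
attribute [local instance] LieRing.ofAssociativeRing
variable {V : Type*} [AddCommGroup V] [Module ℂ V] [FiniteDimensional ℂ V] [Nontrivial V]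

lemma su2_primitive (H e : Module.End ℂ V) (h : H * e - e * H = (2:ℂ) • e) :
    ∃ (μ : ℂ) (v : V), v ≠ 0 ∧ H v = μ • v ∧ e v = 0 := by
  obtain ⟨μ₀, hμ₀⟩ := Module.End.exists_eigenvalue H
  have hfin : Set.Finite {μ : ℂ | H.HasEigenvalue μ} := Module.End.finite_hasEigenvalue H
  obtain ⟨μ, hμ, hmax⟩ := Set.exists_max_image _ Complex.re hfin ⟨μ₀, hμ₀⟩
  obtain ⟨v, hv⟩ := Module.End.HasEigenvalue.exists_hasEigenvector hμ
  refine ⟨μ, v, hv.2, hv.apply_eq_smul, ?_⟩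
  by_contra hne
  have h1 : H (e v) = (μ + 2) • e v := by
    have := congrArg (fun f : Module.End ℂ V => f v) h
    simp [hv.apply_eq_smul] at this
    rw [sub_eq_iff_eq_add] at this
    rw [this, add_smul, add_comm]
  have h2 : H.HasEigenvalue (μ + 2) :=
    Module.End.hasEigenvalue_of_hasEigenvector (x := e v)
      ⟨Module.End.mem_eigenspace_iff.2 h1, hne⟩
  have h3 := hmax _ h2
  simp at h3
  linarith

lemma su2_sl2 (H e f : Module.End ℂ V) (h1 : H * e - e * H = (2:ℂ) • e)
    (h2 : H * f - f * H = -((2:ℂ) • f)) (h3 : e * f - f * e = H) :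
    ∃ (n : ℕ) (v : ℕ → V), (∀ k ≤ n, v k ≠ 0) ∧ (∀ k, H (v k) = ((n : ℂ) - 2 * k) • v k) ∧
      (∀ k, f (v k) = v (k + 1)) ∧ v (n + 1) = 0 ∧ e (v 0) = 0 ∧
      (∀ k, ∃ c : ℂ, e (v (k + 1)) = c • v k) := by
  by_cases hH : H = 0
  · subst hH
    have he : e = 0 := by simpa using h1.symm
    have hf : f = 0 := by simpa using h2
    obtain ⟨w, hw⟩ := exists_ne (0 : V)
    refine ⟨0, fun k => if k = 0 then w else 0, ?_, ?_, ?_, ?_, ?_, ?_⟩ <;> simp [he, hf, hw]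
    intro k; exact ⟨0, by simp⟩
  · obtain ⟨μ, m, hm, hHm, hem⟩ := su2_primitive H e h1
    have t : IsSl2Triple H e f := by
      refine ⟨hH, h3, ?_, ?_⟩
      · rw [Ring.lie_def, h1, two_smul, two_nsmul]
      · rw [Ring.lie_def, h2, two_smul, two_nsmul]
    have P : t.HasPrimitiveVectorWith m μ := ⟨hm, hHm, hem⟩
    obtain ⟨n, hn⟩ := P.exists_nat
    refine ⟨n, fun k => ((LieModule.toEnd ℂ (Module.End ℂ V) V f) ^ k) m, ?_, ?_, ?_, ?_, ?_, ?_⟩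
    · intro k hk
      exact P.pow_toEnd_f_ne_zero_of_eq_nat hn hk
    · intro k
      rw [← hn]
      exact P.lie_h_pow_toEnd_f k
    · intro k
      exact P.lie_f_pow_toEnd_f k
    · exact P.pow_toEnd_f_eq_zero_of_eq_nat hn
    · simpa using hem
    · intro k
      exact ⟨_, P.lie_e_pow_succ_toEnd_f k⟩

/-- Packaged form: an eigenbasis of the invariant subspace. -/
lemma su2_sl2' (H e f : Module.End ℂ V) (h1 : H * e - e * H = (2:ℂ) • e)
    (h2 : H * f - f * H = -((2:ℂ) • f)) (h3 : e * f - f * e = H) :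
    ∃ (n : ℕ) (v : Fin (n + 1) → V), LinearIndependent ℂ v ∧
      (∀ k, H (v k) = ((n : ℂ) - 2 * (k : ℕ)) • v k) ∧
      (∀ w ∈ Submodule.span ℂ (Set.range v), H w ∈ Submodule.span ℂ (Set.range v)) ∧
      (∀ w ∈ Submodule.span ℂ (Set.range v), e w ∈ Submodule.span ℂ (Set.range v)) ∧
      (∀ w ∈ Submodule.span ℂ (Set.range v), f w ∈ Submodule.span ℂ (Set.range v)) := by
  obtain ⟨n, v, hv, hH, hf, hz, he0, he⟩ := su2_sl2 H e f h1 h2 h3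
  have hmem : ∀ k ≤ n, v k ∈ Submodule.span ℂ (Set.range fun k : Fin (n+1) => v k) :=
    fun k hk => Submodule.subset_span ⟨⟨k, by omega⟩, rfl⟩
  have hinv : ∀ g : Module.End ℂ V,
      (∀ k ≤ n, g (v k) ∈ Submodule.span ℂ (Set.range fun k : Fin (n+1) => v k)) →
      ∀ w ∈ Submodule.span ℂ (Set.range fun k : Fin (n+1) => v k),
        g w ∈ Submodule.span ℂ (Set.range fun k : Fin (n+1) => v k) := by
    intro g hg w hw
    have : Submodule.span ℂ (Set.range fun k : Fin (n+1) => v k) ≤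
        (Submodule.span ℂ (Set.range fun k : Fin (n+1) => v k)).comap g := by
      rw [Submodule.span_le]
      rintro _ ⟨k, rfl⟩
      exact hg k (by omega)
    exact this hw
  refine ⟨n, fun k => v k, ?_, fun k => hH k, hinv _ ?_, hinv _ ?_, hinv _ ?_⟩
  · refine Module.End.eigenvectors_linearIndependent' H (fun k : Fin (n+1) => ((n : ℂ) - 2 * (k : ℕ)))
      ?_ _ ?_
    · intro a b hab
      simpa [Fin.ext_iff] using hab
    · intro k
      exact ⟨Module.End.mem_eigenspace_iff.2 (hH k), hv k (by omega)⟩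
  · intro k hk
    rw [hH]
    exact Submodule.smul_mem _ _ (hmem k hk)
  · intro k hk
    rcases k with _ | k
    · rw [he0]; exact Submodule.zero_mem _
    · obtain ⟨c, hc⟩ := he k
      rw [hc]
      exact Submodule.smul_mem _ _ (hmem k (by omega))
  · intro k hk
    rw [hf]
    rcases hk.lt_or_eq with h | h
    · exact hmem _ h
    · rw [h, hz]; exact Submodule.zero_mem _
end sl2

section group
open Filter Topology

/-- Trace-free unit quaternions. -/
structure Su2Im (M : Matrix (Fin 2) (Fin 2) ℂ) : Prop where
  star_eq : star M = -M
  sq : M * M = -1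
  tr : M.trace = 0
  det : M.det = 1

/-- The matrix `cos t + sin t M`. -/
noncomputable def su2Mat (M : Matrix (Fin 2) (Fin 2) ℂ) (t : ℝ) : Matrix (Fin 2) (Fin 2) ℂ :=
  Real.cos t • (1 : Matrix (Fin 2) (Fin 2) ℂ) + Real.sin t • M

lemma su2Mat_add {M : Matrix (Fin 2) (Fin 2) ℂ} (hM : M * M = -1) (s t : ℝ) :
    su2Mat M (s + t) = su2Mat M s * su2Mat M t := by
  simp only [su2Mat, Real.cos_add, Real.sin_add, add_mul, mul_add, smul_mul_smul_comm, hM,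
    one_mul, mul_one]
  module

lemma su2Mat_zero (M : Matrix (Fin 2) (Fin 2) ℂ) : su2Mat M 0 = 1 := by simp [su2Mat]

lemma su2Mat_star {M : Matrix (Fin 2) (Fin 2) ℂ} (hM : Su2Im M) (t : ℝ) :
    star (su2Mat M t) = su2Mat M (-t) := by
  simp [su2Mat, hM.star_eq]

lemma su2_det_aux {M : Matrix (Fin 2) (Fin 2) ℂ} (h1 : M.trace = 0) (h2 : M.det = 1) (c s : ℝ)
    (hcs : c ^ 2 + s ^ 2 = 1) :
    (c • (1 : Matrix (Fin 2) (Fin 2) ℂ) + s • M).det = 1 := by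
  rw [Matrix.det_fin_two] at h2 ⊢
  rw [Matrix.trace_fin_two] at h1
  have hcs' : (c:ℂ) ^ 2 + (s:ℂ) ^ 2 = 1 := by exact_mod_cast hcs
  simp
  linear_combination (c:ℂ) * s * h1 + (s:ℂ)^2 * h2 + hcs'

/-- The one-parameter group of `M`. -/
noncomputable def su2Path {M : Matrix (Fin 2) (Fin 2) ℂ} (hM : Su2Im M) (t : ℝ) : SU2 :=
  ⟨⟨su2Mat M t, by
    rw [Matrix.mem_unitaryGroup_iff, su2Mat_star hM, ← su2Mat_add hM.sq, add_neg_cancel,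
      su2Mat_zero]⟩, by
    have := su2_det_aux hM.tr hM.det (Real.cos t) (Real.sin t) (Real.cos_sq_add_sin_sq t)
    simpa [SU2, MonoidHom.mem_ker, su2Mat] using this⟩

lemma su2_ext {g h : SU2} (H : (g : Matrix (Fin 2) (Fin 2) ℂ) = h) : g = h :=
  Subtype.ext (Subtype.ext H)

lemma su2Path_coe {M : Matrix (Fin 2) (Fin 2) ℂ} (hM : Su2Im M) (t : ℝ) :
    ((su2Path hM t : SU2) : Matrix (Fin 2) (Fin 2) ℂ) = su2Mat M t := rfl

lemma su2_mul_coe (g h : SU2) :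
    ((g * h : SU2) : Matrix (Fin 2) (Fin 2) ℂ) = (g : Matrix (Fin 2) (Fin 2) ℂ) * h := rfl

lemma su2_pow_coe (g : SU2) (n : ℕ) :
    ((g ^ n : SU2) : Matrix (Fin 2) (Fin 2) ℂ) = (g : Matrix (Fin 2) (Fin 2) ℂ) ^ n := rfl

lemma su2Path_add {M : Matrix (Fin 2) (Fin 2) ℂ} (hM : Su2Im M) (s t : ℝ) :
    su2Path hM (s + t) = su2Path hM s * su2Path hM t := su2_ext (su2Mat_add hM.sq s t)

lemma su2Path_zero {M : Matrix (Fin 2) (Fin 2) ℂ} (hM : Su2Im M) : su2Path hM 0 = 1 :=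
  su2_ext (su2Mat_zero M)

lemma su2Path_continuous {M : Matrix (Fin 2) (Fin 2) ℂ} (hM : Su2Im M) :
    Continuous (su2Path hM) := by
  refine Continuous.subtype_mk (Continuous.subtype_mk ?_ _) _
  unfold su2Mat
  exact ((Real.continuous_cos).smul continuous_const).add ((Real.continuous_sin).smul continuous_const)

lemma su2_tendsto {u : ℕ → SU2} {g : SU2}
    (h : Tendsto (fun n => (u n : Matrix (Fin 2) (Fin 2) ℂ)) atTop (𝓝 (g : Matrix (Fin 2) (Fin 2) ℂ))) :
    Tendsto u atTop (𝓝 g) :=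
  tendsto_subtype_rng.2 (tendsto_subtype_rng.2 h)

section norm
attribute [local instance] Matrix.linftyOpNormedAddCommGroup Matrix.linftyOpNormedRing
  Matrix.linftyOpNormedAlgebra Matrix.linfty_opNormOneClass

lemma su2Mat_deriv (M : Matrix (Fin 2) (Fin 2) ℂ) (c : ℝ) :
    HasDerivAt (fun t => su2Mat M (c * t)) (c • M) 0 := by
  have h0 : HasDerivAt (fun t : ℝ => c * t) c 0 := by
    simpa using (hasDerivAt_id (0:ℝ)).const_mul c
  have h1 := (h0.cos.smul_const (1 : Matrix (Fin 2) (Fin 2) ℂ)).fun_add (h0.sin.smul_const M)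
  simp only [mul_zero, Real.sin_zero, Real.cos_zero, neg_zero, zero_mul, zero_smul, zero_add,
    one_mul] at h1
  exact h1

lemma su2Path_trotter {P Q N : Matrix (Fin 2) (Fin 2) ℂ} (hP : Su2Im P) (hQ : Su2Im Q)
    (hN : Su2Im N) (c s : ℝ) (h : N = c • P + s • Q) (t : ℝ) :
    Tendsto (fun n : ℕ => (su2Path hP (c * (t / n)) * su2Path hQ (s * (t / n))) ^ n) atTop
      (𝓝 (su2Path hN t)) := by
  apply su2_tendsto
  have hd1 := (su2Mat_deriv P c).fun_mul (su2Mat_deriv Q s)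
  have hd2 := su2Mat_deriv N 1
  simp only [mul_zero, su2Mat_zero, one_mul, mul_one, ← h, one_smul] at hd1 hd2
  exact su2_trotter (fun x => su2Mat P (c * x) * su2Mat Q (s * x)) (su2Mat N) N
    (by simp [su2Mat_zero]) (su2Mat_zero N) hd1 hd2 (su2Mat_add hN.sq) t

end norm

lemma su2_conj_mat {P Q : Matrix (Fin 2) (Fin 2) ℂ} (hP : Su2Im P)
    (hPQ : Q * P = -(P * Q)) (s t : ℝ) :
    su2Mat P s * su2Mat Q t * su2Mat P (-s) =
      su2Mat (Real.cos (2 * s) • Q + Real.sin (2 * s) • (P * Q)) t := by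
  have h1 : Q * su2Mat P (-s) = su2Mat P s * Q := by
    simp [su2Mat, mul_add, add_mul, hPQ]
  have h2 : su2Mat P s * su2Mat Q t * su2Mat P (-s) =
      Real.cos t • (su2Mat P s * su2Mat P (-s)) +
        Real.sin t • (su2Mat P s * (Q * su2Mat P (-s))) := by
    conv_lhs => rw [su2Mat.eq_def Q t]
    simp only [mul_add, add_mul, smul_mul_assoc, mul_smul_comm, mul_assoc, one_mul]
  rw [h2, h1, ← su2Mat_add hP.sq, ← mul_assoc, ← su2Mat_add hP.sq, add_neg_cancel, su2Mat_zero,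
    ← two_mul]
  simp [su2Mat, add_mul]

lemma su2Im_mul {P Q : Matrix (Fin 2) (Fin 2) ℂ} (hP : Su2Im P) (hQ : Su2Im Q)
    (hPQ : Q * P = -(P * Q)) : Su2Im (P * Q) where
  star_eq := by rw [star_mul, hP.star_eq, hQ.star_eq, neg_mul_neg, hPQ]
  sq := by
    calc P * Q * (P * Q) = P * (Q * P) * Q := by simp only [mul_assoc]
      _ = -((P * P) * (Q * Q)) := by rw [hPQ]; noncomm_ring
      _ = -1 := by rw [hP.sq, hQ.sq]; simp
  tr := by
    have h := Matrix.trace_mul_comm P Q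
    rw [hPQ, Matrix.trace_neg] at h
    exact self_eq_neg.1 h
  det := by rw [Matrix.det_mul, hP.det, hQ.det, one_mul]

lemma su2Im_rot {P Q : Matrix (Fin 2) (Fin 2) ℂ} (hP : Su2Im P) (hQ : Su2Im Q)
    (hPQ : Q * P = -(P * Q)) (c s : ℝ) (hcs : c ^ 2 + s ^ 2 = 1) :
    Su2Im (c • Q + s • (P * Q)) where
  star_eq := by
    rw [star_add, star_smul, star_smul, hQ.star_eq, (su2Im_mul hP hQ hPQ).star_eq]
    simp [add_comm]
  sq := by
    have h1 : Q * (P * Q) = P := by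
      rw [← mul_assoc, hPQ, neg_mul, mul_assoc, hQ.sq]; simp
    have h2 : P * Q * Q = -P := by rw [mul_assoc, hQ.sq]; simp
    simp only [add_mul, mul_add, smul_mul_smul_comm, hQ.sq, (su2Im_mul hP hQ hPQ).sq, h1, h2]
    have : (c * c + s * s) • (-1 : Matrix (Fin 2) (Fin 2) ℂ) = -1 := by
      rw [← pow_two, ← pow_two, hcs, one_smul]
    refine Eq.trans ?_ this
    module
  tr := by
    rw [Matrix.trace_add, Matrix.trace_smul, Matrix.trace_smul, hQ.tr, (su2Im_mul hP hQ hPQ).tr]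
    simp
  det := by
    have : c • Q + s • (P * Q) = (c • (1 : Matrix (Fin 2) (Fin 2) ℂ) + s • P) * Q := by
      simp [add_mul]
    rw [this, Matrix.det_mul, su2_det_aux hP.tr hP.det c s hcs, hQ.det, one_mul]

section rep
variable {E : Type*} [NormedRing E] [NormedAlgebra ℝ E] [NormOneClass E] [CompleteSpace E]

lemma su2_gen_exists (R : SU2 →* E) (hR : Continuous R) {M : Matrix (Fin 2) (Fin 2) ℂ}
    (hM : Su2Im M) : ∃ A : E, ∀ t : ℝ, R (su2Path hM t) = NormedSpace.exp (t • A) :=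
  su2_one_param (fun t => R (su2Path hM t)) (hR.comp (su2Path_continuous hM))
    (by simp [su2Path_zero]) (fun s t => by simp [su2Path_add])

lemma su2_gen_add (R : SU2 →* E) (hR : Continuous R) {P Q N : Matrix (Fin 2) (Fin 2) ℂ}
    (hP : Su2Im P) (hQ : Su2Im Q)
    (hN : Su2Im N) (c s : ℝ) (h : N = c • P + s • Q) {A B D : E}
    (hA : ∀ t : ℝ, R (su2Path hP t) = NormedSpace.exp (t • A))
    (hB : ∀ t : ℝ, R (su2Path hQ t) = NormedSpace.exp (t • B))
    (hD : ∀ t : ℝ, R (su2Path hN t) = NormedSpace.exp (t • D)) : D = c • A + s • B := by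
  apply su2_exp_inj
  intro t
  have h1 := (hR.tendsto _).comp (su2Path_trotter hP hQ hN c s h t)
  rw [hD] at h1
  have h2 := su2_trotter _ (fun t => NormedSpace.exp (t • (c • A + s • B))) _ (by simp) (by simp)
    (su2_exp_smul_add A B c s) (su2_exp_deriv _) (su2_exp_add _) t
  refine tendsto_nhds_unique h1 (h2.congr fun n => ?_)
  simp [hA, hB]

lemma su2_bracket (R : SU2 →* E) (hR : Continuous R) {P Q N : Matrix (Fin 2) (Fin 2) ℂ}
    (hP : Su2Im P) (hQ : Su2Im Q) (hPQ : Q * P = -(P * Q)) (hN : Su2Im N) (hNe : N = P * Q)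
    {A B D : E}
    (hA : ∀ t : ℝ, R (su2Path hP t) = NormedSpace.exp (t • A))
    (hB : ∀ t : ℝ, R (su2Path hQ t) = NormedSpace.exp (t • B))
    (hD : ∀ t : ℝ, R (su2Path hN t) = NormedSpace.exp (t • D)) :
    A * B - B * A = (2 : ℝ) • D := by
  subst hNe
  have key : ∀ s : ℝ, NormedSpace.exp (s • A) * B * NormedSpace.exp ((-s) • A) =
      Real.cos (2 * s) • B + Real.sin (2 * s) • D := by
    intro s
    have hrot := su2Im_rot hP hQ hPQ (Real.cos (2 * s)) (Real.sin (2 * s))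
      (Real.cos_sq_add_sin_sq _)
    obtain ⟨C, hC⟩ := su2_gen_exists R hR hrot
    have hCe := su2_gen_add R hR hQ hN hrot _ _ rfl hB hD hC
    rw [← hCe]
    have h1 : ∀ t : ℝ, NormedSpace.exp (t • C) =
        NormedSpace.exp (s • A) * NormedSpace.exp (t • B) * NormedSpace.exp ((-s) • A) := by
      intro t
      rw [← hC, ← hA, ← hA, ← hB, ← map_mul, ← map_mul]
      congr 1
      exact (su2_ext (su2_conj_mat hP hPQ s t)).symm
    have h2 := ((su2_exp_deriv B).const_mul (NormedSpace.exp (s • A))).mul_const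
      (NormedSpace.exp ((-s) • A))
    have h3 := su2_exp_deriv C
    rw [funext h1] at h3
    exact h2.unique h3
  have hneg : HasDerivAt (fun s : ℝ => NormedSpace.exp ((-s) • A)) (-A) 0 := by
    simpa using su2_exp_deriv (-A)
  have h1 := ((su2_exp_deriv A).mul_const B).fun_mul hneg
  have h2' : HasDerivAt (fun t : ℝ => 2 * t) 2 0 := by
    simpa using (hasDerivAt_id (0:ℝ)).const_mul 2
  have h2 := (h2'.cos.smul_const B).fun_add (h2'.sin.smul_const D)
  rw [funext key] at h1
  have h3 := h1.unique h2
  simpa [sub_eq_add_neg] using h3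

end rep

end group

section final
open Filter Topology

lemma su2Im_K : Su2Im !![I, 0; 0, -I] where
  star_eq := by ext i j; fin_cases i <;> fin_cases j <;> simp
  sq := by ext i j; fin_cases i <;> fin_cases j <;> simp
  tr := by simp [Matrix.trace_fin_two]
  det := by simp [Matrix.det_fin_two]

lemma su2Im_X : Su2Im !![0, 1; -1, 0] where
  star_eq := by ext i j; fin_cases i <;> fin_cases j <;> simp
  sq := by ext i j; fin_cases i <;> fin_cases j <;> simp
  tr := by simp [Matrix.trace_fin_two]
  det := by simp [Matrix.det_fin_two]

lemma su2Im_Y : Su2Im !![0, I; I, 0] where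
  star_eq := by ext i j; fin_cases i <;> fin_cases j <;> simp
  sq := by ext i j; fin_cases i <;> fin_cases j <;> simp
  tr := by simp [Matrix.trace_fin_two]
  det := by simp [Matrix.det_fin_two]

lemma su2_TSU2_eq (θ : ℝ) : TSU2 θ = su2Path su2Im_K θ := by
  apply su2_ext
  change Tmat θ = su2Mat _ θ
  have h1 := Complex.exp_mul_I (θ : ℂ)
  have h2 := Complex.exp_mul_I (-θ : ℂ)
  ext i j
  fin_cases i <;> fin_cases j <;> simp [Tmat, su2Mat, h1]
  rw [← neg_mul, h2]; simp

lemma su2_euler (g : SU2) : ∃ α β γ : ℝ,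
    g = su2Path su2Im_K α * su2Path su2Im_X β * su2Path su2Im_K γ := by
  set G : Matrix (Fin 2) (Fin 2) ℂ := (g : Matrix (Fin 2) (Fin 2) ℂ) with hG
  have hu : G * star G = 1 := Matrix.mem_unitaryGroup_iff.1 g.1.2
  have hd : G.det = 1 := by
    have := g.2
    simpa [SU2, MonoidHom.mem_ker] using this
  have hadj : star G = G.adjugate := by
    have h1 := Matrix.adjugate_mul G
    rw [hd, one_smul] at h1
    calc star G = (G.adjugate * G) * star G := by rw [h1, one_mul]
      _ = G.adjugate := by rw [mul_assoc, hu, mul_one]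
  have h11 : G 1 1 = (starRingEnd ℂ) (G 0 0) := by
    have := congrFun (congrFun hadj 0) 0
    rw [Matrix.adjugate_fin_two] at this
    simpa using this.symm
  have h10 : G 1 0 = - (starRingEnd ℂ) (G 0 1) := by
    have := congrFun (congrFun hadj 1) 0
    rw [Matrix.adjugate_fin_two] at this
    simp at this
    rw [this, neg_neg]
  have hn : ‖G 0 0‖ ^ 2 + ‖G 0 1‖ ^ 2 = 1 := by
    rw [Matrix.det_fin_two, h11, h10, mul_neg, Complex.mul_conj, Complex.mul_conj,
      Complex.normSq_eq_norm_sq, Complex.normSq_eq_norm_sq] at hd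
    have : (((‖G 0 0‖ ^ 2 + ‖G 0 1‖ ^ 2 : ℝ)) : ℂ) = 1 := by
      rw [← hd]; push_cast; ring
    exact_mod_cast this
  set a := G 0 0 with ha
  set b := G 0 1 with hb
  refine ⟨(arg a + arg b) / 2, Real.arccos ‖a‖, (arg a - arg b) / 2, ?_⟩
  have hc : Real.cos (Real.arccos ‖a‖) = ‖a‖ :=
    Real.cos_arccos (by linarith [norm_nonneg a]) (by nlinarith [norm_nonneg a, sq_nonneg ‖b‖])
  have hs : Real.sin (Real.arccos ‖a‖) = ‖b‖ := by
    rw [Real.sin_arccos, ← hn, add_sub_cancel_left, Real.sqrt_sq (norm_nonneg b)]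
  have hea := Complex.norm_mul_exp_arg_mul_I a
  have heb := Complex.norm_mul_exp_arg_mul_I b
  have hca : (starRingEnd ℂ) a = ‖a‖ * Complex.exp (-(arg a) * I) := by
    conv_lhs => rw [← hea]
    rw [map_mul, ← Complex.exp_conj]; simp
  have hcb : (starRingEnd ℂ) b = ‖b‖ * Complex.exp (-(arg b) * I) := by
    conv_lhs => rw [← heb]
    rw [map_mul, ← Complex.exp_conj]; simp
  rw [← su2_TSU2_eq, ← su2_TSU2_eq]
  apply su2_ext
  change G = Tmat _ * su2Mat _ _ * Tmat _
  have hX : su2Mat !![0, 1; -1, 0] (Real.arccos ‖a‖) = !![(‖a‖ : ℂ), ‖b‖; -‖b‖, ‖a‖] := by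
    rw [su2Mat, hc, hs]
    ext i j; fin_cases i <;> fin_cases j <;> simp
  rw [hX, Tmat, Tmat, Matrix.mul_fin_two, Matrix.mul_fin_two]
  have hGe : G = !![a, b; G 1 0, G 1 1] := Matrix.eta_fin_two G
  rw [hGe, h10, h11, hca, hcb]
  have e1 : ∀ x y z : ℂ, Complex.exp x * z * Complex.exp y = z * Complex.exp (x + y) := by
    intro x y z; rw [Complex.exp_add]; ring
  have q1 : (((arg a + arg b) / 2 : ℝ) : ℂ) * I + (((arg a - arg b) / 2 : ℝ) : ℂ) * I = arg a * I := by
    push_cast; ring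
  have q2 : (((arg a + arg b) / 2 : ℝ) : ℂ) * I + -(((arg a - arg b) / 2 : ℝ) : ℂ) * I = arg b * I := by
    push_cast; ring
  have q3 : -(((arg a + arg b) / 2 : ℝ) : ℂ) * I + (((arg a - arg b) / 2 : ℝ) : ℂ) * I = -arg b * I := by
    push_cast; ring
  have q4 : -(((arg a + arg b) / 2 : ℝ) : ℂ) * I + -(((arg a - arg b) / 2 : ℝ) : ℂ) * I =
      -arg a * I := by
    push_cast; ring
  simp only [zero_mul, add_zero, zero_add, mul_zero, e1, q1, q2, q3, q4, hea, heb]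
  simp only [neg_mul]

section exps
variable {V : Type*} [NormedAddCommGroup V] [NormedSpace ℂ V] [FiniteDimensional ℂ V] [Nontrivial V]
  [CompleteSpace V]

lemma su2_exp_apply (A : V →L[ℂ] V) (t : ℝ) (v : V) :
    Tendsto (fun n : ℕ => ((1 + (t / n : ℝ) • A) ^ n) v) atTop (𝓝 (NormedSpace.exp (t • A) v)) := by
  have hd : HasDerivAt (fun t : ℝ => (1 : V →L[ℂ] V) + t • A) A 0 := by
    simpa using ((hasDerivAt_id (0:ℝ)).smul_const A).const_add (1 : V →L[ℂ] V)
  have h := su2_trotter (fun t : ℝ => (1 : V →L[ℂ] V) + t • A)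
    (fun t => NormedSpace.exp (t • A)) A (by simp) (by simp) hd (su2_exp_deriv A) (su2_exp_add A) t
  exact ((ContinuousLinearMap.apply ℂ V v).continuous.tendsto _).comp h

lemma su2_exp_mem (A : V →L[ℂ] V) (W : Submodule ℂ V) (hW : ∀ w ∈ W, A w ∈ W) (t : ℝ) :
    ∀ w ∈ W, NormedSpace.exp (t • A) w ∈ W := by
  intro w hw
  refine (W.closed_of_finiteDimensional).mem_of_tendsto (su2_exp_apply A t w)
    (Eventually.of_forall fun n => ?_)
  have : ∀ k : ℕ, ((1 + (t / n : ℝ) • A) ^ k) w ∈ W := by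
    intro k
    induction k with
    | zero => simpa using hw
    | succ k ih =>
      rw [pow_succ']
      simp only [mul_apply_eq_comp, _root_.add_apply,
        one_apply_eq_self, _root_.smul_apply]
      refine W.add_mem ih ?_
      rw [← Complex.coe_smul]
      exact W.smul_mem _ (hW _ ih)
  exact this n

lemma su2_exp_eigen (A : V →L[ℂ] V) (v : V) (c : ℂ) (hv : A v = c • v) (t : ℝ) :
    NormedSpace.exp (t • A) v = Complex.exp (c * t) • v := by
  have hd : HasDerivAt (fun t : ℝ => (1 : ℂ) + t • c) c 0 := by
    simpa using ((hasDerivAt_id (0:ℝ)).smul_const c).const_add (1 : ℂ)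
  have h := su2_trotter (fun t : ℝ => (1 : ℂ) + t • c)
    (fun t => NormedSpace.exp (t • c)) c (by simp) (by simp) hd (su2_exp_deriv c) (su2_exp_add c) t
  have h2 := h.smul_const v
  have h3 : NormedSpace.exp (t • c) = Complex.exp (c * t) := by
    rw [Complex.exp_eq_exp_ℂ, Complex.real_smul, mul_comm]
  simp only [h3] at h2
  refine tendsto_nhds_unique (su2_exp_apply A t v) (h2.congr fun n => ?_)
  have : ∀ k : ℕ, ((1 + (t / n : ℝ) • c) ^ k) • v = ((1 + (t / n : ℝ) • A) ^ k) v := by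
    intro k
    induction k with
    | zero => simp
    | succ k ih =>
      rw [pow_succ', pow_succ', mul_apply_eq_comp, ← ih, map_smul]
      simp only [_root_.add_apply,
        one_apply_eq_self, _root_.smul_apply, hv]
      rw [mul_comm, mul_smul, add_smul, one_smul, smul_assoc]
  exact this n
end exps

lemma su2_sl2_rel {V : Type*} [AddCommGroup V] [Module ℂ V] (a b d : Module.End ℂ V)
    (h1 : a * b - b * a = (2:ℂ) • d) (h2 : b * d - d * b = (2:ℂ) • a)
    (h3 : d * a - a * d = (2:ℂ) • b) (H e f : Module.End ℂ V) (hH : H = (-I) • a)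
    (he : e = (1/2 : ℂ) • (b - I • d)) (hf : f = (1/2 : ℂ) • (-b - I • d)) :
    H * e - e * H = (2:ℂ) • e ∧ H * f - f * H = -((2:ℂ) • f) ∧ e * f - f * e = H := by
  rw [sub_eq_iff_eq_add] at h1 h2 h3
  subst hH he hf
  refine ⟨?_, ?_, ?_⟩ <;>
  simp only [smul_mul_assoc, mul_smul_comm, mul_sub, sub_mul, mul_neg, neg_mul, h1, h2, h3] <;>
  match_scalars <;> ring_nf <;> simp

end final

/-- **Classification of the irreducible continuous finite-dimensional representations of
`SU(2)` by their characters**: if `ρ : SU(2) → GL(V)` is a continuous homomorphism on a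
nonzero finite-dimensional complex vector space `V` whose only invariant subspaces are `0`
and `V`, then `dim V = n + 1` for some `n` and the character of `ρ` at `T(θ)` is
`Σ_{j=0}^{n} e^{i(n-2j)θ}`. -/
theorem su2_irreducible_rep_classification
    (V : Type*) [NormedAddCommGroup V] [NormedSpace ℂ V] [FiniteDimensional ℂ V]
    [Nontrivial V] (ρ : SU2 →* (V →L[ℂ] V)ˣ)
    (hcont : Continuous fun g : SU2 => ((ρ g : V →L[ℂ] V)))
    (hirr : ∀ W : Submodule ℂ V,
      (∀ g : SU2, ∀ v ∈ W, (ρ g : V →L[ℂ] V) v ∈ W) → W = ⊥ ∨ W = ⊤) :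
    ∃ n : ℕ, Module.finrank ℂ V = n + 1 ∧
      ∀ θ : ℝ, LinearMap.trace ℂ V ((ρ (TSU2 θ) : V →L[ℂ] V) : V →ₗ[ℂ] V) =
        ∑ j ∈ Finset.range (n + 1),
          Complex.exp (Complex.I * ((n : ℂ) - 2 * (j : ℂ)) * (θ : ℂ)) := by
  have : CompleteSpace V := FiniteDimensional.complete ℂ V
  set R : SU2 →* (V →L[ℂ] V) := (Units.coeHom (V →L[ℂ] V)).comp ρ with hRdef
  have hRa : ∀ g, R g = (ρ g : V →L[ℂ] V) := fun g => rfl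
  have hR : Continuous R := hcont
  obtain ⟨A, hA⟩ := su2_gen_exists R hR su2Im_K
  obtain ⟨B, hB⟩ := su2_gen_exists R hR su2Im_X
  obtain ⟨D, hD⟩ := su2_gen_exists R hR su2Im_Y
  have b1 : A * B - B * A = (2 : ℝ) • D := by
    refine su2_bracket R hR su2Im_K su2Im_X ?_ su2Im_Y ?_ hA hB hD <;>
    · ext i j; fin_cases i <;> fin_cases j <;> simp
  have b2 : B * D - D * B = (2 : ℝ) • A := by
    refine su2_bracket R hR su2Im_X su2Im_Y ?_ su2Im_K ?_ hB hD hA <;>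
    · ext i j; fin_cases i <;> fin_cases j <;> simp
  have b3 : D * A - A * D = (2 : ℝ) • B := by
    refine su2_bracket R hR su2Im_Y su2Im_K ?_ su2Im_X ?_ hD hA hB <;>
    · ext i j; fin_cases i <;> fin_cases j <;> simp
  have conv : ∀ A B D : V →L[ℂ] V, A * B - B * A = (2 : ℝ) • D →
      (A : Module.End ℂ V) * (B : Module.End ℂ V) - (B : Module.End ℂ V) * (A : Module.End ℂ V)
        = (2 : ℂ) • (D : Module.End ℂ V) := by
    intro A B D h
    ext v
    have := congrArg (fun f : V →L[ℂ] V => f v) h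
    simp only [_root_.sub_apply, mul_apply_eq_comp, _root_.smul_apply] at this
    rw [← Complex.coe_smul] at this
    simpa using this
  obtain ⟨r1, r2, r3⟩ := su2_sl2_rel (A : Module.End ℂ V) B D (conv _ _ _ b1) (conv _ _ _ b2)
    (conv _ _ _ b3) _ _ _ rfl rfl rfl
  obtain ⟨n, v, hli, hHv, wH, we, wf⟩ := su2_sl2' _ _ _ r1 r2 r3
  set W := Submodule.span ℂ (Set.range v) with hWdef
  have wA : ∀ w ∈ W, A w ∈ W := by
    intro w hw
    have h := W.smul_mem I (wH w hw)
    have e : I • (((-I) • (A : Module.End ℂ V)) w) = A w := by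
      simp [smul_smul]
    rwa [e] at h
  have wB : ∀ w ∈ W, B w ∈ W := by
    intro w hw
    have h := W.sub_mem (we w hw) (wf w hw)
    have e : ((1/2 : ℂ) • ((B : Module.End ℂ V) - I • (D : Module.End ℂ V))) w -
        ((1/2 : ℂ) • (-(B : Module.End ℂ V) - I • (D : Module.End ℂ V))) w = B w := by
      simp
      module
    rwa [e] at h
  have hWinv : ∀ g : SU2, ∀ w ∈ W, (ρ g : V →L[ℂ] V) w ∈ W := by
    intro g w hw
    obtain ⟨α, β, γ, rfl⟩ := su2_euler g
    rw [← hRa, map_mul, map_mul, hA, hA, hB]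
    exact su2_exp_mem A W wA α _ (su2_exp_mem B W wB β _ (su2_exp_mem A W wA γ _ hw))
  have hWtop : W = ⊤ := by
    refine (hirr W hWinv).resolve_left fun h => ?_
    have h0 : v 0 ∈ W := Submodule.subset_span ⟨0, rfl⟩
    rw [h, Submodule.mem_bot] at h0
    exact hli.ne_zero 0 h0
  let bb : Module.Basis (Fin (n + 1)) ℂ V := Module.Basis.mk hli hWtop.ge
  have hbb : ∀ k, bb k = v k := fun k => Module.Basis.mk_apply _ _ k
  refine ⟨n, ?_, fun θ => ?_⟩
  · rw [Module.finrank_eq_card_basis bb, Fintype.card_fin]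
  · have hev : ∀ k, (ρ (TSU2 θ) : V →L[ℂ] V) (v k) =
        Complex.exp (I * ((n : ℂ) - 2 * ((k : ℕ) : ℂ)) * (θ : ℂ)) • v k := by
      intro k
      rw [← hRa, su2_TSU2_eq, hA]
      apply su2_exp_eigen
      rw [mul_smul, ← hHv k]
      simp [smul_smul]
    rw [LinearMap.trace_eq_matrix_trace ℂ bb, Matrix.trace, Finset.sum_range]
    refine Finset.sum_congr rfl fun k _ => ?_
    rw [Matrix.diag_apply, LinearMap.toMatrix_apply, ContinuousLinearMap.coe_coe, hbb, hev, ← hbb,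
      map_smul, Module.Basis.repr_self]
    simp
end

section
/- Rational structure on level-one modular forms: for every integer k, the complex vector space of modular forms of weight k for the full modular group SL(2,ℤ) is spanned by modular forms all of whose q-expansion coefficients lie in ℚ. -/
open Real Complex
open scoped UpperHalfPlane

section Helpers

open UpperHalfPlane ModularForm ModularFormClass MatrixGroups EisensteinSeries

/-- The power series over `ℂ` with rational coefficients. -/
noncomputable def ratSeries : Subring (PowerSeries ℂ) := (PowerSeries.map (algebraMap ℚ ℂ)).range

lemma mem_ratSeries_of_coeff {p : PowerSeries ℂ} (a : ℕ → ℚ) (h : ∀ n, p.coeff n = (a n : ℂ)) :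
    p ∈ ratSeries :=
  ⟨PowerSeries.mk a, by ext n; simp [h]⟩

lemma E_mem_ratSeries {k : ℕ} (hk : 3 ≤ k) (hk2 : Even k) :
    qExpansion 1 (E hk) ∈ ratSeries := by
  refine mem_ratSeries_of_coeff
    (fun m => if m = 0 then 1 else
      -(2 * k / bernoulli k : ℚ) * (ArithmeticFunction.sigma (k - 1) m : ℕ)) fun n => ?_
  rw [E_qExpansion_coeff hk hk2]
  split_ifs <;> simp

lemma discriminant_mem_ratSeries : qExpansion 1 ModularForm.discriminant ∈ ratSeries := by
  have key : (CuspForm.discriminant : ℍ → ℂ) =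
      ((1 / 1728 : ℂ) • (ModularForm.mcast (b := 12) (by decide) (E₄.pow 3) -
        ModularForm.mcast (by decide) (E₆.pow 2)) : ModularForm 𝒮ℒ 12) := by
    ext z
    change ModularForm.discriminant z = (1 / 1728 : ℂ) * (E₄ z ^ 3 - E₆ z ^ 2)
    rw [discriminant_eq_E₄_cube_sub_E₆_sq z]; ring
  rw [← CuspForm.coe_discriminant, key, FunLike.coe_smul,
    ModularForm.qExpansion_smul one_pos one_mem_strictPeriods_SL, FunLike.coe_sub,
    ModularForm.qExpansion_sub one_pos one_mem_strictPeriods_SL, coe_mcast, coe_mcast,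
    ModularForm.qExpansion_pow one_pos one_mem_strictPeriods_SL,
    ModularForm.qExpansion_pow one_pos one_mem_strictPeriods_SL, PowerSeries.smul_eq_C_mul]
  refine mul_mem (mem_ratSeries_of_coeff (fun n => if n = 0 then 1 / 1728 else 0) fun n => ?_)
    (sub_mem (pow_mem (E_mem_ratSeries _ ⟨2, rfl⟩) _) (pow_mem (E_mem_ratSeries _ ⟨3, rfl⟩) _))
  rw [PowerSeries.coeff_C]
  split_ifs <;> simp

/-- The span of the modular forms with rational coefficients. -/
noncomputable def ratSpan (k : ℤ) : Submodule ℂ (ModularForm 𝒮ℒ k) :=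
  Submodule.span ℂ {g | qExpansion 1 g ∈ ratSeries}

lemma mem_ratSpan (n : ℕ) : ∀ k : ℤ, k < 12 * n → ∀ f : ModularForm 𝒮ℒ k, f ∈ ratSpan k := by
  induction n with
  | zero =>
    intro k hk f
    rw [rank_zero_iff_forall_zero.mp (levelOne_neg_weight_rank_zero (by simpa using hk)) f]
    exact zero_mem _
  | succ n ih =>
    intro k hk f
    rcases lt_or_ge k 0 with h0 | h0
    · rw [rank_zero_iff_forall_zero.mp (levelOne_neg_weight_rank_zero h0) f]
      exact zero_mem _
    rcases Int.even_or_odd k with he | ho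
    swap
    · rw [levelOne_odd_weight_eq_zero ho f]
      exact zero_mem _
    lift k to ℕ using h0
    have he' : Even k := by exact_mod_cast he
    rcases lt_or_ge k 3 with h3 | h3
    · interval_cases k
      · obtain ⟨c, hc⟩ := levelOne_weight_zero_const f
        have : f = c • (1 : ModularForm 𝒮ℒ 0) := by
          ext z
          simp [hc]
        rw [this]
        refine Submodule.smul_mem _ _ (Submodule.subset_span ?_)
        change qExpansion 1 (1 : ℍ → ℂ) ∈ ratSeries
        rw [qExpansion_one]
        exact one_mem _
      · exact absurd he' (by decide)
      · rw [rank_zero_iff_forall_zero.mp levelOne_weight_two_rank_zero f]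
        exact zero_mem _
    · obtain ⟨g, hg⟩ := sub_smul_isCuspForm f (E h3) (E_qExpansion_coeff_zero h3 he')
      have hf : f = CuspForm.toModularFormₗ g + (qExpansion 1 f).coeff 0 • E h3 := by
        rw [hg]; abel
      rw [hf]
      refine add_mem ?_ (Submodule.smul_mem _ _ (Submodule.subset_span (E_mem_ratSeries h3 he')))
      have hh := ih ((k : ℤ) - 12) (by push_cast at hk; lia) (CuspForm.discriminantEquiv g)
      let L : ModularForm 𝒮ℒ ((k : ℤ) - 12) →ₗ[ℂ] ModularForm 𝒮ℒ (k : ℤ) :=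
        CuspForm.toModularFormₗ ∘ₗ CuspForm.discriminantEquiv.symm.toLinearMap
      have hL : L (CuspForm.discriminantEquiv g) = CuspForm.toModularFormₗ g := by
        simp [L]
      rw [← hL]
      have hle : ratSpan ((k : ℤ) - 12) ≤ (ratSpan k).comap L := by
        refine Submodule.span_le.mpr fun u hu => Submodule.subset_span ?_
        change qExpansion 1 (CuspForm.discriminant * u : ℍ → ℂ) ∈ ratSeries
        rw [ModularForm.qExpansion_mul_coe one_pos one_mem_strictPeriods_SL]
        exact mul_mem discriminant_mem_ratSeries hu
      exact hle hh

lemma exists_of_mem_ratSeries {k : ℤ} (f : ModularForm 𝒮ℒ k) (h : qExpansion 1 f ∈ ratSeries) :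
    ∃ a : ℕ → ℚ, ∀ τ : ℍ, f τ = ∑' n : ℕ,
      (a n : ℂ) * Complex.exp (2 * Real.pi * Complex.I * (τ : ℂ)) ^ n := by
  obtain ⟨p, hp⟩ := h
  refine ⟨fun n => p.coeff n, fun τ => ?_⟩
  have hcusp : Fact (IsCusp OnePoint.infty 𝒮ℒ) :=
    ⟨Subgroup.isCusp_of_mem_strictPeriods one_pos one_mem_strictPeriods_SL⟩
  have := (UpperHalfPlane.hasSum_qExpansion one_pos
    (SlashInvariantFormClass.periodic_comp_ofComplex f one_mem_strictPeriods_SL) (holo f)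
    (bdd_at_infty f) τ).tsum_eq
  rw [← this, ← hp]
  simp [Function.Periodic.qParam]

lemma span_aux (Γ : Subgroup (GL (Fin 2) ℝ)) [Γ.HasDetOne] (hΓ : Γ = 𝒮ℒ) (k : ℤ) :
    (⊤ : Submodule ℂ (ModularForm Γ k)) = Submodule.span ℂ
        {f : ModularForm Γ k |
          ∃ a : ℕ → ℚ, ∀ τ : ℍ, f τ = ∑' n : ℕ,
            (a n : ℂ) * Complex.exp (2 * Real.pi * Complex.I * (τ : ℂ)) ^ n} := by
  subst hΓ
  refine (top_le_iff.mp fun f _ => ?_).symm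
  exact Submodule.span_mono (fun g hg => exists_of_mem_ratSeries g hg)
    (mem_ratSpan (k.toNat + 1) k (by lia) f)

end Helpers


/-- **Rational structure on level-one modular forms**: the space of modular forms of weight
`k` for the full modular group `SL(2, ℤ)` is spanned (over `ℂ`) by the modular forms all of
whose q-expansion coefficients are rational. -/
theorem modular_forms_spanned_by_rational (k : ℤ) :
    (⊤ : Submodule ℂ (ModularForm (⊤ : Subgroup (Matrix.SpecialLinearGroup (Fin 2) ℤ)) k)) =
      Submodule.span ℂ
        {f : ModularForm (⊤ : Subgroup (Matrix.SpecialLinearGroup (Fin 2) ℤ)) k |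
          ∃ a : ℕ → ℚ, ∀ τ : ℍ, f τ = ∑' n : ℕ,
            (a n : ℂ) * Complex.exp (2 * Real.pi * Complex.I * (τ : ℂ)) ^ n} := by
  exact span_aux _ (MonoidHom.range_eq_map _).symm k
end
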